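/- (Explicit smoothing threshold; quantitative form of Theorem 3.) Let N ≥ 1, let h_1, …, h_N : ℝⁿ → ℝ be continuously differentiable, let F : ℝⁿ → ℝⁿ, and let ε, M, r, d > 0 be constants such that for every x in the tube T_ε := {x : 0 ≤ ĥ(x) ≤ ε} and every i ∈ {1,…,N}: |L_F h_i(x)| ≤ M, and either L_F h_i(x) ≥ r or δ_i(x) ≥ d. Then for every θ > θ* := max{ (log N)/ε , (1/d)·log( N(r+M)/r ) } and every x ∈ ℝⁿ with h̃_θ(x) = 0, one has L_F h̃_θ(x) > 0; in particular D h̃_θ(x) ≠ 0, so 0 is a regular value of h̃_θ. -/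

import Mathlib

/-- The pointwise minimum `ĥ(x) = min_{1 ≤ i ≤ N} h_i(x)`. -/
noncomputable def hmin {n N : ℕ} (hN : 0 < N) (h : Fin N → (Fin n → ℝ) → ℝ)
    (x : Fin n → ℝ) : ℝ :=
  Finset.univ.inf' (Finset.univ_nonempty_iff.mpr ⟨⟨0, hN⟩⟩) fun i => h i x

/-- The soft-min (log-sum-exp) `h̃_θ(x) = -(1/θ) log (∑ i, exp (-θ h_i x))`. -/
noncomputable def softmin {n N : ℕ} (θ : ℝ) (h : Fin N → (Fin n → ℝ) → ℝ)
    (x : Fin n → ℝ) : ℝ :=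
  -(1 / θ) * Real.log (∑ i, Real.exp (-θ * h i x))

/-- The Lie derivative `L_F g(x) = D g(x)(F(x))` of `g` along the vector field `F`. -/
noncomputable def lieD {n : ℕ} (F : (Fin n → ℝ) → (Fin n → ℝ)) (g : (Fin n → ℝ) → ℝ)
    (x : Fin n → ℝ) : ℝ :=
  fderiv ℝ g x (F x)

theorem lieD_softmin {n N : ℕ} (hN : 0 < N) {θ : ℝ} (hθ : θ ≠ 0)
    {h : Fin N → (Fin n → ℝ) → ℝ} {x : Fin n → ℝ}
    (hd : ∀ i, DifferentiableAt ℝ (h i) x) (F : (Fin n → ℝ) → (Fin n → ℝ)) :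
    lieD F (softmin θ h) x =
      (∑ i, Real.exp (-θ * h i x) * lieD F (h i) x) / ∑ i, Real.exp (-θ * h i x) := by
  have hpos : 0 < ∑ i, Real.exp (-θ * h i x) :=
    Finset.sum_pos (fun i _ => Real.exp_pos _) ⟨⟨0, hN⟩, Finset.mem_univ _⟩
  have hsum : HasFDerivAt (fun y => ∑ i, Real.exp (-θ * h i y))
      (∑ i, Real.exp (-θ * h i x) • (-θ • fderiv ℝ (h i) x)) x :=
    HasFDerivAt.fun_sum fun i _ => ((hd i).hasFDerivAt.const_mul (-θ)).exp
  have hsoft : HasFDerivAt (softmin θ h) _ x := (hsum.log hpos.ne').const_mul (-(1 / θ))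
  have hterm : ∑ i, Real.exp (-θ * h i x) * (-θ * fderiv ℝ (h i) x (F x)) =
      -θ * ∑ i, Real.exp (-θ * h i x) * fderiv ℝ (h i) x (F x) := by
    rw [Finset.mul_sum]
    exact Finset.sum_congr rfl fun i _ => by ring
  simp only [lieD, hsoft.fderiv, smul_apply, sum_apply, smul_eq_mul, hterm]
  field_simp

theorem sum_exp_eq_one_of_softmin_eq_zero {n N : ℕ} (hN : 0 < N) {θ : ℝ} (hθ : θ ≠ 0)
    {h : Fin N → (Fin n → ℝ) → ℝ} {x : Fin n → ℝ} (hx : softmin θ h x = 0) :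
    ∑ i, Real.exp (-θ * h i x) = 1 := by
  have hpos : 0 < ∑ i, Real.exp (-θ * h i x) :=
    Finset.sum_pos (fun i _ => Real.exp_pos _) ⟨⟨0, hN⟩, Finset.mem_univ _⟩
  have hlog : Real.log (∑ i, Real.exp (-θ * h i x)) = 0 :=
    (mul_eq_zero.mp hx).resolve_left (neg_ne_zero.mpr (one_div_ne_zero hθ))
  exact Real.eq_one_of_pos_of_log_eq_zero hpos hlog

theorem hmin_nonneg_of_softmin_eq_zero {n N : ℕ} (hN : 0 < N) {θ : ℝ} (hθ : 0 < θ)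
    {h : Fin N → (Fin n → ℝ) → ℝ} {x : Fin n → ℝ} (hx : softmin θ h x = 0) :
    0 ≤ hmin hN h x := by
  refine Finset.le_inf' _ _ fun i hi => ?_
  have hle : Real.exp (-θ * h i x) ≤ 1 :=
    (Finset.single_le_sum (f := fun i => Real.exp (-θ * h i x))
      (fun j _ => (Real.exp_pos _).le) hi).trans_eq
      (sum_exp_eq_one_of_softmin_eq_zero hN hθ.ne' hx)
  rw [Real.exp_le_one_iff] at hle
  nlinarith

theorem mul_hmin_le_log_of_softmin_eq_zero {n N : ℕ} (hN : 0 < N) {θ : ℝ} (hθ : 0 < θ)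
    {h : Fin N → (Fin n → ℝ) → ℝ} {x : Fin n → ℝ} (hx : softmin θ h x = 0) :
    θ * hmin hN h x ≤ Real.log N := by
  have hNpos : (0 : ℝ) < N := Nat.cast_pos.mpr hN
  have hle : ∑ i, Real.exp (-θ * h i x) ≤ ∑ _i : Fin N, Real.exp (-θ * hmin hN h x) := by
    refine Finset.sum_le_sum fun i hi => Real.exp_le_exp.mpr ?_
    have hi' : hmin hN h x ≤ h i x := Finset.inf'_le _ hi
    nlinarith
  rw [sum_exp_eq_one_of_softmin_eq_zero hN hθ.ne' hx, Finset.sum_const, Finset.card_univ,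
    Fintype.card_fin, nsmul_eq_mul] at hle
  have hlog := Real.log_le_log one_pos hle
  rw [Real.log_one, Real.log_mul hNpos.ne' (Real.exp_pos _).ne', Real.log_exp] at hlog
  linarith

/-- explicit smoothing threshold, quantitative Theorem 3: if on the tube
`T_ε = {x : 0 ≤ ĥ(x) ≤ ε}` every index `i` satisfies `|L_F h_i(x)| ≤ M` and either
`L_F h_i(x) ≥ r` or `δ_i(x) ≥ d`, then for every
`θ > θ* = max{(log N)/ε, (1/d) log (N(r+M)/r)}` and every `x` on the zero level set of
`h̃_θ`, one has `L_F h̃_θ(x) > 0`, and in particular `D h̃_θ(x) ≠ 0`. -/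
theorem softmin_explicit_threshold {n N : ℕ} (hN : 0 < N)
    (h : Fin N → (Fin n → ℝ) → ℝ) (hC1 : ∀ i, ContDiff ℝ 1 (h i))
    (F : (Fin n → ℝ) → (Fin n → ℝ))
    (ε M r d : ℝ) (hε : 0 < ε) (hM : 0 < M) (hr : 0 < r) (hd : 0 < d)
    (htube : ∀ x : Fin n → ℝ, 0 ≤ hmin hN h x → hmin hN h x ≤ ε →
      ∀ i, |lieD F (h i) x| ≤ M ∧
        (r ≤ lieD F (h i) x ∨ d ≤ h i x - hmin hN h x)) :
    ∀ θ : ℝ,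
      max (Real.log N / ε) ((1 / d) * Real.log ((N : ℝ) * (r + M) / r)) < θ →
      ∀ x : Fin n → ℝ, softmin θ h x = 0 →
        0 < lieD F (softmin θ h) x ∧ fderiv ℝ (softmin θ h) x ≠ 0 := by
  intro θ hθ x hx
  obtain ⟨hθε, hθd⟩ := max_lt_iff.mp hθ
  have hNpos : (0 : ℝ) < N := Nat.cast_pos.mpr hN
  have hN1 : (1 : ℝ) ≤ N := Nat.one_le_cast.mpr hN
  have hquot : 1 < (N : ℝ) * (r + M) / r := by
    rw [one_lt_div hr]
    nlinarith
  have hθpos : 0 < θ := (mul_pos (one_div_pos.mpr hd) (Real.log_pos hquot)).trans hθd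
  have hexp : (N : ℝ) * (r + M) * Real.exp (-(θ * d)) < r := by
    rw [one_div_mul_eq_div, div_lt_iff₀ hd,
      Real.log_lt_iff_lt_exp (one_pos.trans hquot), div_lt_iff₀ hr] at hθd
    rw [Real.exp_neg, ← div_eq_mul_inv, div_lt_iff₀ (Real.exp_pos _)]
    linarith
  have hmin0 := hmin_nonneg_of_softmin_eq_zero hN hθpos hx
  have hminε : hmin hN h x ≤ ε := by
    have hle := mul_hmin_le_log_of_softmin_eq_zero hN hθpos hx
    rw [div_lt_iff₀ hε] at hθε
    exact le_of_mul_le_mul_left (hle.trans hθε.le) hθpos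
  have hsum := sum_exp_eq_one_of_softmin_eq_zero hN hθpos.ne' hx
  have hterm : ∀ i, r * Real.exp (-θ * h i x) - r / N <
      Real.exp (-θ * h i x) * lieD F (h i) x := by
    intro i
    have hw := Real.exp_pos (-θ * h i x)
    have hrN : 0 < r / N := div_pos hr hNpos
    obtain ⟨hbound, hgood | hgap⟩ := htube x hmin0 hminε i
    · nlinarith
    · have hwle : Real.exp (-θ * h i x) ≤ Real.exp (-(θ * d)) :=
        Real.exp_le_exp.mpr (by nlinarith)
      have hsmall : (r + M) * Real.exp (-θ * h i x) < r / N := by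
        rw [lt_div_iff₀ hNpos]
        have := mul_le_mul_of_nonneg_left hwle (by positivity : 0 ≤ (N : ℝ) * (r + M))
        linarith
      nlinarith [(abs_le.mp hbound).1]
  have hpos : 0 < lieD F (softmin θ h) x := by
    rw [lieD_softmin hN hθpos.ne'
      (fun i => (hC1 i).differentiable one_ne_zero x) F, hsum, div_one]
    have hlt := Finset.sum_lt_sum_of_nonempty
      (⟨⟨0, hN⟩, Finset.mem_univ _⟩ : (Finset.univ : Finset (Fin N)).Nonempty)
      fun i _ => hterm i
    rw [Finset.sum_sub_distrib, ← Finset.mul_sum, hsum, Finset.sum_const, Finset.card_univ,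
      Fintype.card_fin, nsmul_eq_mul, mul_div_cancel₀ _ hNpos.ne'] at hlt
    linarith
  refine ⟨hpos, fun hzero => hpos.ne' ?_⟩
  simp [lieD, hzero]
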